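/- Suppose |λ_j| = λ_s > 0 for all j ∈ P_S, |λ_k| = λ_u > 0 for all k ∈ P_U, and all μ_{kℓ} equal a common constant μ ≥ 1 for (k,ℓ) ∈ E(P). Suppose there exist constants T_0 ≥ 0 and ρ ∈ [0, λ_s/(λ_s+λ_u)) such that the total duration of activation of unstable subsystems satisfies T^U(s,t) := Σ_{k∈P_U} T_k(s,t) ≤ T_0 + ρ(t−s) for every 0 ≤ s < t. If, in addition, σ satisfies an average dwell time: there exist N_0 > 0 and τ_a > 0 with N(s,t) ≤ N_0 + (t−s)/τ_a for every 0 ≤ s < t and τ_a > (ln μ)/(λ_s(1−ρ) − λ_u ρ), then the switched system ẋ(t) = f_{σ(t)}(x(t)) is globally asymptotically stable under σ. -/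

import Mathlib

open Filter MeasureTheory Set

noncomputable section

/-- A switching signal: strictly increasing switching instants `tau 0 = 0 < tau 1 < ...`
tending to `+∞`, together with the signal `sig` itself, constant on `[tau i, tau (i+1))`
and actually switching at each `tau (i+1)`. -/
structure SwitchSig (P : Type*) where
  tau : ℕ → ℝ
  sig : ℝ → P
  tau0 : tau 0 = 0
  mono : StrictMono tau
  tends : Filter.Tendsto tau Filter.atTop Filter.atTop
  const : ∀ i : ℕ, ∀ t : ℝ, tau i ≤ t → t < tau (i + 1) → sig t = sig (tau i)
  switch : ∀ i : ℕ, sig (tau i) ≠ sig (tau (i + 1))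

namespace SwitchSig

variable {P : Type*} (S : SwitchSig P)

/-- `N s t` : the number of switching instants in `(s, t]`. -/
def N (s t : ℝ) : ℕ := Set.ncard {i : ℕ | s < S.tau i ∧ S.tau i ≤ t}

/-- `Ntrans k l t` : the number of transitions from `k` to `l` occurring up to time `t`. -/
def Ntrans (k l : P) (t : ℝ) : ℕ :=
  Set.ncard {i : ℕ | S.tau (i + 1) ≤ t ∧ S.sig (S.tau i) = k ∧ S.sig (S.tau (i + 1)) = l}

/-- `Nmode j s t` : the number of switching instants in `(s, t]` at which subsystem `j`
is activated. -/
def Nmode (j : P) (s t : ℝ) : ℕ :=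
  Set.ncard {i : ℕ | s < S.tau i ∧ S.tau i ≤ t ∧ S.sig (S.tau i) = j}

/-- `T j s t` : the total duration of activation of subsystem `j` on `(s, t]`
(Lebesgue measure). -/
def T (j : P) (s t : ℝ) : ℝ :=
  (MeasureTheory.volume {r : ℝ | s < r ∧ r ≤ t ∧ S.sig r = j}).toReal

/-- switching frequency `ν(t) = N(0,t)/t`. -/
def nu (t : ℝ) : ℝ := (S.N 0 t : ℝ) / t

/-- transition frequency `ρ_{kl}(t) = N_{kl}(0,t)/N(0,t)`. -/
def rho (k l : P) (t : ℝ) : ℝ := (S.Ntrans k l t : ℝ) / (S.N 0 t : ℝ)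

/-- fraction of activation `η_j(t) = T_j(0,t)/t`. -/
def eta (j : P) (t : ℝ) : ℝ := S.T j 0 t / t

end SwitchSig

/-- A (Carathéodory-type) solution of the switched system `ẋ = f_{σ(t)}(x)`:
continuous on `[0, ∞)` and differentiable, with the prescribed derivative, in the
interior of every inter-switch interval. -/
def IsSolution {P : Type*} {E : Type*} [NormedAddCommGroup E] [NormedSpace ℝ E]
    (S : SwitchSig P) (f : P → E → E) (x : ℝ → E) : Prop :=
  ContinuousOn x (Set.Ici (0 : ℝ)) ∧
  ∀ i : ℕ, ∀ t : ℝ, S.tau i < t → t < S.tau (i + 1) →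
    HasDerivAt x (f (S.sig t) (x t)) t

/-- Class `K∞` functions. -/
def ClassKInf (g : ℝ → ℝ) : Prop :=
  ContinuousOn g (Set.Ici (0 : ℝ)) ∧ StrictMonoOn g (Set.Ici (0 : ℝ)) ∧ g 0 = 0 ∧
  Filter.Tendsto g Filter.atTop Filter.atTop

/-- Assumption 1: Lyapunov-like functions `V i`, sandwiched between class-`K∞`
functions of the norm, decaying at rate `lam i` (positive on `PS`, negative on `PU`)
along solutions of each subsystem. -/
def Assumption1 {P : Type*} {E : Type*} [NormedAddCommGroup E] [NormedSpace ℝ E]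
    (f : P → E → E) (V : P → E → ℝ) (lam : P → ℝ) (PS PU : Finset P)
    (lo hi : ℝ → ℝ) : Prop :=
  ClassKInf lo ∧ ClassKInf hi ∧
  (∀ i : P, ContDiff ℝ 1 (V i)) ∧
  (∀ i : P, ∀ ξ : E, 0 ≤ V i ξ) ∧
  (∀ j ∈ PS, 0 < lam j) ∧ (∀ k ∈ PU, lam k < 0) ∧
  (∀ i : P, ∀ ξ : E, lo ‖ξ‖ ≤ V i ξ ∧ V i ξ ≤ hi ‖ξ‖) ∧
  (∀ i : P, ∀ γ : ℝ → E, ContinuousOn γ (Set.Ici (0 : ℝ)) →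
    (∀ t : ℝ, 0 < t → HasDerivAt γ (f i (γ t)) t) →
    ∀ t : ℝ, 0 ≤ t → V i (γ t) ≤ V i (γ 0) * Real.exp (-(lam i) * t))

/-- Assumption 2: for every admissible transition `(i, j)` there is `μ_{ij} ≥ 1`
with `V j ≤ μ_{ij} • V i` pointwise. -/
def Assumption2 {P : Type*} {E : Type*}
    (V : P → E → ℝ) (mu : P → P → ℝ) (Eadm : Finset (P × P)) : Prop :=
  ∀ p ∈ Eadm, 1 ≤ mu p.1 p.2 ∧ ∀ ξ : E, V p.2 ξ ≤ mu p.1 p.2 * V p.1 ξ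

/-- Global asymptotic stability of the switched system under the switching signal `S`:
Lyapunov stability together with global asymptotic convergence of every solution. -/
def IsGAS {P : Type*} {E : Type*} [NormedAddCommGroup E] [NormedSpace ℝ E]
    (S : SwitchSig P) (f : P → E → E) : Prop :=
  (∀ ε : ℝ, 0 < ε → ∃ δ : ℝ, 0 < δ ∧ ∀ x : ℝ → E, IsSolution S f x → ‖x 0‖ < δ →
      ∀ t : ℝ, 0 ≤ t → ‖x t‖ < ε) ∧
  ∀ x : ℝ → E, IsSolution S f x → Filter.Tendsto x Filter.atTop (nhds (0 : E))

/-- Exponentially discounting the integral of a function of exponential growth keeps it bounded. -/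
theorem norm_exp_smul_integral_le {E : Type*} [NormedAddCommGroup E] [NormedSpace ℝ E]
    {g : ℝ → E} {c M T : ℝ} (hc : 0 < c) (hT : 0 ≤ T) (hM : 0 ≤ M)
    (hg : ∀ s, 0 ≤ s → ‖g s‖ ≤ M * Real.exp (c * s)) :
    ‖Real.exp (-(c * T)) • ∫ s in (0 : ℝ)..T, g s‖ ≤ M / c := by
  have hint : ‖∫ s in (0 : ℝ)..T, g s‖ ≤ ∫ s in (0 : ℝ)..T, M * Real.exp (c * s) :=
    intervalIntegral.norm_integral_le_of_norm_le hT
      (ae_of_all _ fun s hs => hg s hs.1.le) (Continuous.intervalIntegrable (by fun_prop) _ _)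
  have hval : ∫ s in (0 : ℝ)..T, M * Real.exp (c * s) = M / c * (Real.exp (c * T) - 1) := by
    rw [intervalIntegral.integral_const_mul,
      intervalIntegral.integral_comp_mul_left (fun s => Real.exp s) hc.ne']
    simp only [mul_zero, integral_exp, Real.exp_zero, smul_eq_mul]
    field_simp
  rw [norm_smul, Real.norm_eq_abs, Real.abs_exp]
  calc Real.exp (-(c * T)) * ‖∫ s in (0 : ℝ)..T, g s‖
      ≤ Real.exp (-(c * T)) * (M / c * Real.exp (c * T)) := by
        gcongr
        rw [hval] at hint
        have : 0 ≤ M / c := by positivity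
        linarith
    _ = M / c * (Real.exp (-(c * T)) * Real.exp (c * T)) := by ring
    _ = M / c := by rw [← Real.exp_add]; simp

/-- A globally Lipschitz vector field has a forward-complete solution through every point. -/
theorem LipschitzWith.exists_forward_solution {E : Type*} [NormedAddCommGroup E]
    [NormedSpace ℝ E] [CompleteSpace E] {K : NNReal} {f : E → E} (hf : LipschitzWith K f)
    (y₀ : E) :
    ∃ γ : ℝ → E, γ 0 = y₀ ∧ Continuous γ ∧ ∀ t, 0 < t → HasDerivAt γ (f (γ t)) t := by
  set c : ℝ := 2 * (K + 1) with hc_def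
  have hc : 0 < c := by positivity
  have hfc : Continuous f := hf.continuous
  have hcont : ∀ z : BoundedContinuousFunction ℝ E,
      Continuous fun s => f (Real.exp (c * s) • z s) := fun z => by fun_prop
  have hint : ∀ (z : BoundedContinuousFunction ℝ E) (a b : ℝ),
      IntervalIntegrable (fun s => f (Real.exp (c * s) • z s)) volume a b :=
    fun z a b => (hcont z).intervalIntegrable a b
  have hprim : ∀ z : BoundedContinuousFunction ℝ E,
      Continuous fun t => ∫ s in (0 : ℝ)..t, f (Real.exp (c * s) • z s) := fun z =>
    intervalIntegral.continuous_primitive (hint z) 0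
  let G : BoundedContinuousFunction ℝ E → ℝ → E := fun z t =>
    Real.exp (-(c * max t 0)) • (y₀ + ∫ s in (0 : ℝ)..max t 0, f (Real.exp (c * s) • z s))
  have hGcont : ∀ z, Continuous (G z) := fun z =>
    (by fun_prop : Continuous fun t : ℝ => Real.exp (-(c * max t 0))).smul
      (continuous_const.add ((hprim z).comp (by fun_prop : Continuous fun t : ℝ => max t 0)))
  have hGbd : ∀ z t, ‖G z t‖ ≤ ‖y₀‖ + (‖f 0‖ + K * ‖z‖) / c := by
    intro z t
    have hT : (0 : ℝ) ≤ max t 0 := le_max_right _ _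
    simp only [G, smul_add]
    refine (norm_add_le _ _).trans (add_le_add ?_ ?_)
    · rw [norm_smul, Real.norm_eq_abs, Real.abs_exp]
      exact mul_le_of_le_one_left (norm_nonneg _)
        (Real.exp_le_one_iff.2 (by have := mul_nonneg hc.le hT; linarith))
    · refine norm_exp_smul_integral_le hc hT (by positivity) fun s hs => ?_
      have h1 : ‖f (Real.exp (c * s) • z s)‖ ≤ ‖f 0‖ + K * (Real.exp (c * s) * ‖z s‖) := by
        have h := hf.dist_le_mul (Real.exp (c * s) • z s) 0
        rw [dist_eq_norm, dist_zero_right, norm_smul, Real.norm_eq_abs, Real.abs_exp] at h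
        have h' := norm_sub_norm_le (f (Real.exp (c * s) • z s)) (f 0)
        linarith
      have h2 : 1 ≤ Real.exp (c * s) := Real.one_le_exp (by positivity)
      have h3 : K * (Real.exp (c * s) * ‖z s‖) ≤ K * (Real.exp (c * s) * ‖z‖) := by
        gcongr; exact z.norm_coe_le_norm s
      nlinarith [norm_nonneg (f 0)]
  let Φ : BoundedContinuousFunction ℝ E → BoundedContinuousFunction ℝ E := fun z =>
    BoundedContinuousFunction.ofNormedAddCommGroup (G z) (hGcont z) _ (hGbd z)
  have hΦ : ContractingWith (1 / 2) Φ := by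
    refine ⟨by norm_num, LipschitzWith.of_dist_le_mul fun z w => ?_⟩
    refine (BoundedContinuousFunction.dist_le (by positivity)).2 fun t => ?_
    have hT : (0 : ℝ) ≤ max t 0 := le_max_right _ _
    have hsub : Φ z t - Φ w t = Real.exp (-(c * max t 0)) •
        ∫ s in (0 : ℝ)..max t 0, (f (Real.exp (c * s) • z s) - f (Real.exp (c * s) • w s)) := by
      rw [intervalIntegral.integral_sub (hint z _ _) (hint w _ _)]
      simp only [Φ, G, BoundedContinuousFunction.coe_ofNormedAddCommGroup, ← smul_sub,
        add_sub_add_left_eq_sub]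
    rw [dist_eq_norm, hsub]
    refine (norm_exp_smul_integral_le (M := K * dist z w) hc hT (by positivity)
      fun s _ => ?_).trans ?_
    · have h := hf.dist_le_mul (Real.exp (c * s) • z s) (Real.exp (c * s) • w s)
      rw [dist_smul₀, dist_eq_norm, Real.norm_eq_abs, Real.abs_exp] at h
      refine h.trans ?_
      have := BoundedContinuousFunction.dist_coe_le_dist (f := z) (g := w) s
      calc (K : ℝ) * (Real.exp (c * s) * dist (z s) (w s))
          ≤ K * (Real.exp (c * s) * dist z w) := by gcongr
        _ = _ := by ring
    · rw [div_le_iff₀ hc, hc_def]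
      push_cast
      nlinarith [dist_nonneg (x := z) (y := w)]
  obtain ⟨z, hz⟩ : ∃ z, Φ z = z := ⟨_, hΦ.fixedPoint_isFixedPt⟩
  have hγ : ∀ t, 0 ≤ t → Real.exp (c * t) • z t =
      y₀ + ∫ s in (0 : ℝ)..t, f (Real.exp (c * s) • z s) := by
    intro t ht
    have h : z t = G z t := congrArg (fun w : BoundedContinuousFunction ℝ E => w t) hz.symm
    rw [h]
    simp only [G, max_eq_left ht, smul_smul, ← Real.exp_add]
    simp
  refine ⟨fun t => Real.exp (c * t) • z t, by simpa using hγ 0 le_rfl, by fun_prop,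
    fun t ht => ?_⟩
  have hd : HasDerivAt (fun t => y₀ + ∫ s in (0 : ℝ)..t, f (Real.exp (c * s) • z s))
      (f (Real.exp (c * t) • z t)) t :=
    (intervalIntegral.integral_hasDerivAt_right (hint z _ _)
      ((hcont z).stronglyMeasurableAtFilter _ _) (hcont z).continuousAt).const_add y₀
  exact hd.congr_of_eventuallyEq
    (by filter_upwards [lt_mem_nhds ht] with s hs using hγ s hs.le)

/-- A continuous function solving `ẏ = f y` on the interior of an interval also solves it, in the
sense of right derivatives, at the left end point. -/
theorem hasDerivWithinAt_Ici_of_hasDerivAt_Ioo {E : Type*} [NormedAddCommGroup E]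
    [NormedSpace ℝ E] {f : E → E} (hf : Continuous f) {y : ℝ → E} {a b : ℝ}
    (hy : ContinuousOn y (Icc a b))
    (hy' : ∀ t ∈ Ioo a b, HasDerivAt y (f (y t)) t) {t : ℝ} (ht : t ∈ Ico a b) :
    HasDerivWithinAt y (f (y t)) (Ici t) t := by
  rcases ht.1.eq_or_lt with rfl | hat
  · have hmem : Ioo a b ∈ nhdsWithin a (Ioi a) := Ioo_mem_nhdsGT ht.2
    have hc : ContinuousWithinAt y (Ioo a b) a :=
      (hy a ⟨le_rfl, ht.2.le⟩).mono Ioo_subset_Icc_self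
    refine hasDerivWithinAt_Ici_of_tendsto_deriv
      (fun s hs => (hy' s hs).differentiableAt.differentiableWithinAt) hc hmem ?_
    have hlim : Tendsto (fun s => f (y s)) (nhdsWithin a (Ioi a)) (nhds (f (y a))) :=
      (hf.tendsto _).comp (hc.tendsto.mono_left (nhdsWithin_le_iff.2 hmem))
    refine hlim.congr' ?_
    filter_upwards [hmem] with s hs using (hy' s hs).deriv.symm
  · exact (hy' t ⟨hat, ht.2⟩).hasDerivWithinAt

/-- An exponential estimate valid along all forward-complete solutions of a Lipschitz vector field
also holds along solutions defined on a compact interval. -/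
theorem le_mul_exp_of_solution_on_Icc {E : Type*} [NormedAddCommGroup E]
    [NormedSpace ℝ E] [CompleteSpace E] {K : NNReal} {f : E → E} (hf : LipschitzWith K f)
    {V : E → ℝ} {l : ℝ}
    (hV : ∀ γ : ℝ → E, ContinuousOn γ (Ici 0) → (∀ t, 0 < t → HasDerivAt γ (f (γ t)) t) →
      ∀ t, 0 ≤ t → V (γ t) ≤ V (γ 0) * Real.exp (-l * t))
    {y : ℝ → E} {a b : ℝ} (hy : ContinuousOn y (Icc a b))
    (hy' : ∀ t ∈ Ioo a b, HasDerivAt y (f (y t)) t) {t : ℝ} (ht : t ∈ Icc a b) :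
    V (y t) ≤ V (y a) * Real.exp (-l * (t - a)) := by
  obtain ⟨γ, hγ0, hγc, hγ'⟩ := hf.exists_forward_solution (y a)
  have hδc : Continuous fun s => γ (s - a) := by fun_prop
  have hδ : ∀ s ∈ Ioo a b, HasDerivAt (fun s => γ (s - a)) (f (γ (s - a))) s := fun s hs =>
    (hγ' (s - a) (sub_pos.2 hs.1)).comp_sub_const s a
  have heq : EqOn y (fun s => γ (s - a)) (Icc a b) :=
    ODE_solution_unique (v := fun _ => f) (fun _ => hf) hy
      (fun s hs => hasDerivWithinAt_Ici_of_hasDerivAt_Ioo hf.continuous hy hy' hs)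
      hδc.continuousOn
      (fun s hs => hasDerivWithinAt_Ici_of_hasDerivAt_Ioo hf.continuous hδc.continuousOn hδ hs)
      (by simp [hγ0])
  rw [heq ht, ← hγ0]
  exact hV γ hγc.continuousOn hγ' _ (sub_nonneg.2 ht.1)

namespace SwitchSig

variable {P : Type*} (S : SwitchSig P)

theorem tau_nonneg (i : ℕ) : 0 ≤ S.tau i := by
  rw [← S.tau0]; exact S.mono.monotone (Nat.zero_le i)

theorem exists_mem_Ico_tau {t : ℝ} (ht : 0 ≤ t) : ∃ i, t ∈ Ico (S.tau i) (S.tau (i + 1)) := by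
  have hex : ∃ n, t < S.tau n := (S.tends.eventually_gt_atTop t).exists
  classical
  obtain ⟨n, hn⟩ : ∃ n, Nat.find hex = n + 1 := by
    refine Nat.exists_eq_succ_of_ne_zero fun h => ?_
    have := Nat.find_spec hex
    rw [h, S.tau0] at this
    linarith
  exact ⟨n, not_lt.1 (Nat.find_min hex (by omega)), hn ▸ Nat.find_spec hex⟩

theorem le_N_of_tau_le {i : ℕ} {t : ℝ} (h : S.tau i ≤ t) : i ≤ S.N 0 t := by
  have hfin : {j : ℕ | 0 < S.tau j ∧ S.tau j ≤ t}.Finite := by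
    obtain ⟨n, hn⟩ := (S.tends.eventually_gt_atTop t).exists
    refine (Set.finite_Iio n).subset fun j hj => ?_
    exact S.mono.lt_iff_lt.1 (hj.2.trans_lt hn)
  have hsub : (Finset.Icc 1 i : Set ℕ) ⊆ {j : ℕ | 0 < S.tau j ∧ S.tau j ≤ t} := by
    intro j hj
    rw [Finset.coe_Icc] at hj
    refine ⟨?_, (S.mono.monotone hj.2).trans h⟩
    rw [← S.tau0]
    exact S.mono hj.1
  have := Set.ncard_le_ncard hsub hfin
  rwa [Set.ncard_coe_finset, Nat.card_Icc, Nat.add_sub_cancel] at this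

theorem T_ne_top (j : P) (s t : ℝ) : volume {r : ℝ | s < r ∧ r ≤ t ∧ S.sig r = j} ≠ ⊤ :=
  measure_ne_top_of_subset (fun _ hr => (⟨hr.1, hr.2.1⟩ : _ ∈ Ioc s t)) measure_Ioc_lt_top.ne

theorem T_mono (j : P) (s : ℝ) {t t' : ℝ} (h : t ≤ t') : S.T j s t ≤ S.T j s t' :=
  ENNReal.toReal_mono (S.T_ne_top j s t')
    (measure_mono fun _ hr => ⟨hr.1, hr.2.1.trans h, hr.2.2⟩)

theorem T_add_le {i : ℕ} {t : ℝ} (ht : t ∈ Icc (S.tau i) (S.tau (i + 1))) :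
    S.T (S.sig (S.tau i)) 0 (S.tau i) + (t - S.tau i) ≤ S.T (S.sig (S.tau i)) 0 t := by
  set j := S.sig (S.tau i)
  have hdisj : Disjoint {r : ℝ | 0 < r ∧ r ≤ S.tau i ∧ S.sig r = j} (Ioo (S.tau i) t) :=
    Set.disjoint_left.2 fun r hr hr' => (hr.2.1.trans_lt hr'.1).false
  have hsub : {r : ℝ | 0 < r ∧ r ≤ S.tau i ∧ S.sig r = j} ∪ Ioo (S.tau i) t ⊆
      {r : ℝ | 0 < r ∧ r ≤ t ∧ S.sig r = j} := by
    rintro r (hr | hr)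
    · exact ⟨hr.1, hr.2.1.trans ht.1, hr.2.2⟩
    · exact ⟨(S.tau_nonneg i).trans_lt hr.1, hr.2.le,
        S.const i r hr.1.le (hr.2.trans_le ht.2)⟩
  have h := ENNReal.toReal_mono (S.T_ne_top j 0 t) (measure_mono hsub)
  rw [measure_union hdisj measurableSet_Ioo,
    ENNReal.toReal_add (S.T_ne_top j 0 _) (by simp), Real.volume_Ioo,
    ENNReal.toReal_ofReal (sub_nonneg.2 ht.1)] at h
  exact h

theorem sum_T_mono (A : Finset P) {t t' : ℝ} (h : t ≤ t') :
    ∑ k ∈ A, S.T k 0 t ≤ ∑ k ∈ A, S.T k 0 t' :=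
  Finset.sum_le_sum fun k _ => S.T_mono k 0 h

theorem sum_T_add_le {A : Finset P} {i : ℕ} (hi : S.sig (S.tau i) ∈ A) {t : ℝ}
    (ht : t ∈ Icc (S.tau i) (S.tau (i + 1))) :
    ∑ k ∈ A, S.T k 0 (S.tau i) + (t - S.tau i) ≤ ∑ k ∈ A, S.T k 0 t := by
  classical
  rw [← Finset.add_sum_erase A _ hi, ← Finset.add_sum_erase A (fun k => S.T k 0 t) hi]
  have h1 := S.T_add_le ht
  have h2 : ∑ k ∈ A.erase (S.sig (S.tau i)), S.T k 0 (S.tau i) ≤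
      ∑ k ∈ A.erase (S.sig (S.tau i)), S.T k 0 t :=
    Finset.sum_le_sum fun k _ => S.T_mono k 0 ht.1
  linarith

end SwitchSig

/-- Along a solution, the active Lyapunov-like function is controlled by the number of switches
and the total activation time of the unstable subsystems. -/
theorem IsSolution.active_V_le {P E : Type*} [NormedAddCommGroup E] [NormedSpace ℝ E]
    [CompleteSpace E] {S : SwitchSig P} {f : P → E → E} {x : ℝ → E} (hx : IsSolution S f x)
    (hLip : ∀ i, ∃ K : NNReal, LipschitzWith K (f i)) {V : P → E → ℝ} {lam : P → ℝ}
    (hV : ∀ i ξ, 0 ≤ V i ξ)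
    (hdecay : ∀ i, ∀ γ : ℝ → E, ContinuousOn γ (Ici 0) →
      (∀ t, 0 < t → HasDerivAt γ (f i (γ t)) t) →
      ∀ t, 0 ≤ t → V i (γ t) ≤ V i (γ 0) * Real.exp (-(lam i) * t))
    {μ : ℝ} (hμ : 1 ≤ μ)
    (hjump : ∀ i ξ, V (S.sig (S.tau (i + 1))) ξ ≤ μ * V (S.sig (S.tau i)) ξ)
    {A : Finset P} {lams lamu : ℝ} (hlam : 0 ≤ lams + lamu)
    (hA : ∀ i ∈ A, lam i = -lamu) (hA' : ∀ i ∉ A, lam i = lams)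
    (i : ℕ) {t : ℝ} (ht : t ∈ Icc (S.tau i) (S.tau (i + 1))) :
    V (S.sig (S.tau i)) (x t) ≤ V (S.sig 0) (x 0) *
      Real.exp (i * Real.log μ - lams * t + (lams + lamu) * ∑ k ∈ A, S.T k 0 t) := by
  have hstep : ∀ (i : ℕ) {t : ℝ}, t ∈ Icc (S.tau i) (S.tau (i + 1)) →
      V (S.sig (S.tau i)) (x t) ≤ V (S.sig (S.tau i)) (x (S.tau i)) *
        Real.exp (-lams * (t - S.tau i) + (lams + lamu) *
          (∑ k ∈ A, S.T k 0 t - ∑ k ∈ A, S.T k 0 (S.tau i))) := by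
    intro i t ht
    obtain ⟨K, hK⟩ := hLip (S.sig (S.tau i))
    refine (le_mul_exp_of_solution_on_Icc hK (hdecay _)
      (hx.1.mono fun s hs => (S.tau_nonneg i).trans hs.1) (fun s hs => ?_) ht).trans ?_
    · have h := hx.2 i s hs.1 hs.2
      rwa [S.const i s hs.1.le hs.2] at h
    · refine mul_le_mul_of_nonneg_left (Real.exp_le_exp.2 ?_) (hV _ _)
      by_cases hi : S.sig (S.tau i) ∈ A
      · rw [hA _ hi]
        nlinarith [mul_le_mul_of_nonneg_left (S.sum_T_add_le hi ht) hlam]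
      · rw [hA' _ hi]
        nlinarith [mul_le_mul_of_nonneg_left (S.sum_T_mono A ht.1) hlam]
  have hstart : V (S.sig (S.tau i)) (x (S.tau i)) ≤ V (S.sig 0) (x 0) *
      Real.exp (i * Real.log μ - lams * S.tau i +
        (lams + lamu) * ∑ k ∈ A, S.T k 0 (S.tau i)) := by
    clear ht
    induction i with
    | zero =>
      have hU : 0 ≤ ∑ k ∈ A, S.T k 0 0 := Finset.sum_nonneg fun _ _ => ENNReal.toReal_nonneg
      rw [S.tau0]
      refine le_mul_of_one_le_right (hV _ _) (Real.one_le_exp ?_)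
      have := mul_nonneg hlam hU
      simpa using this
    | succ n ih =>
      have hn := hstep n (t := S.tau (n + 1)) ⟨S.mono.monotone n.le_succ, le_rfl⟩
      have hμ0 : (0 : ℝ) < μ := by linarith
      calc V (S.sig (S.tau (n + 1))) (x (S.tau (n + 1)))
          ≤ μ * V (S.sig (S.tau n)) (x (S.tau (n + 1))) := hjump _ _
        _ ≤ Real.exp (Real.log μ) * (V (S.sig 0) (x 0) *
              Real.exp (n * Real.log μ - lams * S.tau n +
                (lams + lamu) * ∑ k ∈ A, S.T k 0 (S.tau n)) *
              Real.exp (-lams * (S.tau (n + 1) - S.tau n) + (lams + lamu) *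
                (∑ k ∈ A, S.T k 0 (S.tau (n + 1)) - ∑ k ∈ A, S.T k 0 (S.tau n)))) := by
            rw [Real.exp_log hμ0]
            refine mul_le_mul_of_nonneg_left (hn.trans ?_) hμ0.le
            exact mul_le_mul_of_nonneg_right ih (Real.exp_nonneg _)
        _ = _ := by
            rw [mul_assoc, mul_left_comm, ← Real.exp_add, ← Real.exp_add]
            push_cast
            ring_nf
  refine (hstep i ht).trans
    ((mul_le_mul_of_nonneg_right hstart (Real.exp_nonneg _)).trans_eq ?_)
  rw [mul_assoc, ← Real.exp_add]
  ring_nf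

/-- A uniform exponential bound in terms of class-`K∞` functions implies global asymptotic
stability. -/
theorem isGAS_of_exp_bound {P E : Type*} [NormedAddCommGroup E] [NormedSpace ℝ E]
    {S : SwitchSig P} {f : P → E → E} {lo hi : ℝ → ℝ} (hlo : ClassKInf lo) (hhi : ClassKInf hi)
    {C κ : ℝ} (hκ : 0 < κ)
    (hbd : ∀ x, IsSolution S f x → ∀ t, 0 ≤ t →
      lo ‖x t‖ ≤ hi ‖x 0‖ * Real.exp (C - κ * t)) :
    IsGAS S f := by
  obtain ⟨-, hloM, hlo0, -⟩ := hlo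
  obtain ⟨hhic, hhiM, hhi0, -⟩ := hhi
  have hlt : ∀ {ε : ℝ} {ξ : E}, 0 < ε → lo ‖ξ‖ < lo ε → ‖ξ‖ < ε := fun hε h =>
    (hloM.lt_iff_lt (mem_Ici.2 (norm_nonneg _)) (mem_Ici.2 hε.le)).1 h
  have hpos : ∀ {ε : ℝ}, 0 < ε → 0 < lo ε := fun {ε} hε => by
    rw [← hlo0]; exact hloM (mem_Ici.2 le_rfl) (mem_Ici.2 hε.le) hε
  refine ⟨fun ε hε => ?_, fun x hx => ?_⟩
  · have hη : 0 < lo ε * Real.exp (-C) := mul_pos (hpos hε) (Real.exp_pos _)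
    obtain ⟨δ, hδ, h⟩ := Metric.continuousWithinAt_iff.1 (hhic 0 (mem_Ici.2 le_rfl)) _ hη
    refine ⟨δ, hδ, fun x hx hx0 t ht => hlt hε ?_⟩
    have h1 := h (mem_Ici.2 (norm_nonneg (x 0))) (by simpa using hx0)
    rw [hhi0, dist_zero_right, Real.norm_eq_abs] at h1
    have h2 := (le_abs_self _).trans_lt h1
    calc lo ‖x t‖ ≤ hi ‖x 0‖ * Real.exp (C - κ * t) := hbd x hx t ht
      _ < lo ε * Real.exp (-C) * Real.exp (C - κ * t) :=
          mul_lt_mul_of_pos_right h2 (Real.exp_pos _)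
      _ = lo ε * Real.exp (-(κ * t)) := by
          rw [mul_assoc, ← Real.exp_add]; ring_nf
      _ ≤ lo ε := mul_le_of_le_one_right (hpos hε).le
          (Real.exp_le_one_iff.2 (by have := mul_nonneg hκ.le ht; linarith))
  · have hlim : Tendsto (fun t => hi ‖x 0‖ * Real.exp (C - κ * t)) atTop (nhds 0) := by
      have h1 : Tendsto (fun t : ℝ => C - κ * t) atTop atBot :=
        tendsto_atBot_add_const_left _ C
          (tendsto_neg_atTop_atBot.comp (tendsto_id.const_mul_atTop hκ))
      simpa using (Real.tendsto_exp_atBot.comp h1).const_mul (hi ‖x 0‖)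
    rw [Metric.tendsto_nhds]
    intro ε hε
    filter_upwards [hlim.eventually_lt_const (hpos hε), eventually_ge_atTop 0] with t h ht
    rw [dist_zero_right]
    exact hlt hε ((hbd x hx t ht).trans_lt h)

theorem stmt3 {d : ℕ} {P : Type*}
    (S : SwitchSig P)
    (f : P → EuclideanSpace ℝ (Fin d) → EuclideanSpace ℝ (Fin d))
    (PS PU : Finset P) (Eadm : Finset (P × P))
    (V : P → EuclideanSpace ℝ (Fin d) → ℝ) (lam : P → ℝ) (mu : P → P → ℝ)
    (lo hi : ℝ → ℝ)
    (hcover : ∀ i : P, i ∈ PS ∨ i ∈ PU) (hdisj : Disjoint PS PU)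
    (hLip : ∀ i : P, ∃ K : NNReal, LipschitzWith K (f i))
    (hzero : ∀ i : P, f i 0 = 0)
    (hadm : ∀ i : ℕ, (S.sig (S.tau i), S.sig (S.tau (i + 1))) ∈ Eadm)
    (h1 : Assumption1 f V lam PS PU lo hi)
    (h2 : Assumption2 V mu Eadm)
    (muc lams lamu : ℝ)
    (hmuc : 1 ≤ muc) (hmuconst : ∀ p ∈ Eadm, mu p.1 p.2 = muc)
    (hlams : 0 < lams) (hlamu : 0 < lamu)
    (hlamS : ∀ j ∈ PS, |lam j| = lams) (hlamU : ∀ k ∈ PU, |lam k| = lamu)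
    (T0 ρ : ℝ) (hT0 : 0 ≤ T0) (hρ0 : 0 ≤ ρ) (hρ1 : ρ < lams / (lams + lamu))
    (hTU : ∀ s t : ℝ, 0 ≤ s → s < t → (∑ k ∈ PU, S.T k s t) ≤ T0 + ρ * (t - s))
    (N0 taua : ℝ) (hN0 : 0 < N0) (htaua : 0 < taua)
    (hADT : ∀ s t : ℝ, 0 ≤ s → s < t → (S.N s t : ℝ) ≤ N0 + (t - s) / taua)
    (htbig : Real.log muc / (lams * (1 - ρ) - lamu * ρ) < taua) :
    IsGAS S f := by
  obtain ⟨hlo, hhi, -, hVnn, hPS, hPU, hsand, hdecay⟩ := h1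
  have hlam : 0 < lams + lamu := by linarith
  have hAU : ∀ i ∈ PU, lam i = -lamu := fun i hi => by
    rw [← hlamU i hi, abs_of_neg (hPU i hi), neg_neg]
  have hAS : ∀ i ∉ PU, lam i = lams := fun i hi => by
    have hiS := (hcover i).resolve_right hi
    rw [← hlamS i hiS, abs_of_pos (hPS i hiS)]
  have hjump : ∀ i ξ, V (S.sig (S.tau (i + 1))) ξ ≤ muc * V (S.sig (S.tau i)) ξ := by
    intro i ξ
    have h := (h2 _ (hadm i)).2 ξ
    rwa [hmuconst _ (hadm i)] at h
  have hlog : 0 ≤ Real.log muc := Real.log_nonneg hmuc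
  rw [lt_div_iff₀ hlam] at hρ1
  have hD : 0 < lams * (1 - ρ) - lamu * ρ := by linarith
  rw [div_lt_iff₀ hD, ← div_lt_iff₀' htaua] at htbig
  have hκ : 0 < lams * (1 - ρ) - lamu * ρ - Real.log muc / taua := sub_pos.2 htbig
  refine isGAS_of_exp_bound (C := N0 * Real.log muc + (lams + lamu) * T0) hlo hhi hκ
    fun x hx t ht => ?_
  obtain ⟨i, hi⟩ := S.exists_mem_Ico_tau ht
  rcases ht.eq_or_lt with rfl | ht0
  · refine ((hsand (S.sig 0) _).1.trans (hsand (S.sig 0) _).2).trans ?_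
    refine le_mul_of_one_le_right ((hVnn (S.sig 0) _).trans (hsand (S.sig 0) _).2)
      (Real.one_le_exp ?_)
    rw [mul_zero, sub_zero]
    positivity
  · have hact := hx.active_V_le hLip hVnn hdecay hmuc hjump hlam.le hAU hAS i ⟨hi.1, hi.2.le⟩
    have hN : (i : ℝ) ≤ N0 + t / taua := by
      have h := hADT 0 t le_rfl ht0
      rw [sub_zero] at h
      exact (Nat.cast_le.2 (S.le_N_of_tau_le hi.1)).trans h
    have hU := hTU 0 t le_rfl ht0
    rw [sub_zero] at hU
    refine (hsand _ _).1.trans (hact.trans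
      (mul_le_mul (hsand _ _).2 (Real.exp_le_exp.2 ?_) (Real.exp_nonneg _)
        ((hVnn (S.sig 0) _).trans (hsand _ _).2)))
    have e1 := mul_le_mul_of_nonneg_right hN hlog
    have e2 := mul_le_mul_of_nonneg_left hU hlam.le
    have e3 : Real.log muc / taua * t = t / taua * Real.log muc := by ring
    linarith
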